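/- arXiv:2505.07104 — 2 statements merged into one kernel-verified Lean document; each statement's English description precedes it below -/
import Mathlib

section
/- Let P, Q : ℝ → ℝ be continuous functions, and let x, y : ℝ → ℝ be differentiable functions satisfying x'(τ) = y(τ) + P(τ) and y'(τ) = (1 − 3 a(τ)²) x(τ) + Q(τ). Define M(τ) = (b'(τ) x(τ) − b(τ) y(τ))/a(τ) and W(τ) = H̃(τ) x(τ) − H(τ) y(τ). Then for all τ ∈ ℝ, M'(τ) = −(b(τ)/a(τ)) M(τ) + (1/a(τ))(b'(τ) P(τ) − b(τ) Q(τ)) and W'(τ) = (b(τ)/a(τ)) W(τ) + H̃(τ) P(τ) − H(τ) Q(τ). -/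
/-- `a(τ) = 2√2/(e^τ + e^{−τ})`. -/
noncomputable def aa (τ : ℝ) : ℝ := 2 * Real.sqrt 2 / (Real.exp τ + Real.exp (-τ))

/-- `b(τ) = 2√2 (e^{−τ} − e^τ)/(e^τ + e^{−τ})²`. -/
noncomputable def bb (τ : ℝ) : ℝ :=
  2 * Real.sqrt 2 * (Real.exp (-τ) - Real.exp τ) / (Real.exp τ + Real.exp (-τ)) ^ 2

/-- `b'(τ) = a(τ) − a(τ)³`. -/
noncomputable def bder (τ : ℝ) : ℝ := aa τ - (aa τ) ^ 3

/-- `h(τ) = 3(e^{2τ} − e^{−2τ} + 4τ)/(2(e^τ + e^{−τ})²)`. -/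
noncomputable def hh (τ : ℝ) : ℝ :=
  3 * (Real.exp (2 * τ) - Real.exp (-(2 * τ)) + 4 * τ) / (2 * (Real.exp τ + Real.exp (-τ)) ^ 2)

/-- `H(τ) = (b(τ)h(τ) + a(τ))/a(τ)`. -/
noncomputable def HH (τ : ℝ) : ℝ := (bb τ * hh τ + aa τ) / aa τ

/-- `H̃(τ) = (b'(τ)h(τ) + 2b(τ))/a(τ)`. -/
noncomputable def HT (τ : ℝ) : ℝ := (bder τ * hh τ + 2 * bb τ) / aa τ

theorem aa_ne_zero (τ : ℝ) : aa τ ≠ 0 := by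
  unfold aa
  positivity

/-- First integral: `b² = a² − a⁴/2`. -/
theorem bb_sq (τ : ℝ) : bb τ ^ 2 = aa τ ^ 2 - aa τ ^ 4 / 2 := by
  have hs : Real.sqrt 2 ^ 2 = 2 := Real.sq_sqrt (by norm_num)
  have hs4 : Real.sqrt 2 ^ 4 = 4 := by
    rw [show Real.sqrt 2 ^ 4 = (Real.sqrt 2 ^ 2) ^ 2 by ring, hs]
    norm_num
  have hc : Real.exp τ ≠ 0 := (Real.exp_pos τ).ne'
  have hd : Real.exp τ + (Real.exp τ)⁻¹ ≠ 0 := by positivity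
  unfold aa bb
  simp only [Real.exp_neg, div_pow, mul_pow, hs, hs4]
  field_simp
  ring

theorem hasDerivAt_exp_add_exp_neg (τ : ℝ) :
    HasDerivAt (fun s => Real.exp s + Real.exp (-s)) (Real.exp τ - Real.exp (-τ)) τ := by
  refine ((Real.hasDerivAt_exp τ).add (hasDerivAt_neg τ).exp).congr_deriv ?_
  ring

theorem hasDerivAt_exp_neg_sub_exp (τ : ℝ) :
    HasDerivAt (fun s => Real.exp (-s) - Real.exp s) (-(Real.exp τ + Real.exp (-τ))) τ := by
  refine ((hasDerivAt_neg τ).exp.sub (Real.hasDerivAt_exp τ)).congr_deriv ?_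
  ring

theorem hasDerivAt_aa (τ : ℝ) : HasDerivAt aa (bb τ) τ := by
  have hd : Real.exp τ + Real.exp (-τ) ≠ 0 := by positivity
  refine ((hasDerivAt_const τ (2 * Real.sqrt 2)).div
    (hasDerivAt_exp_add_exp_neg τ) hd).congr_deriv ?_
  unfold bb
  ring

theorem hasDerivAt_bb (τ : ℝ) : HasDerivAt bb (bder τ) τ := by
  have hd : Real.exp τ + Real.exp (-τ) ≠ 0 := by positivity
  refine (((hasDerivAt_exp_neg_sub_exp τ).const_mul (2 * Real.sqrt 2)).div
    ((hasDerivAt_exp_add_exp_neg τ).pow 2) (pow_ne_zero 2 hd)).congr_deriv ?_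
  have hs : Real.sqrt 2 ^ 3 = 2 * Real.sqrt 2 := by
    rw [pow_succ, Real.sq_sqrt (by norm_num)]
  have hc : Real.exp τ ≠ 0 := (Real.exp_pos τ).ne'
  have hd' : Real.exp τ + (Real.exp τ)⁻¹ ≠ 0 := by positivity
  unfold bder aa
  simp only [Pi.pow_apply, Nat.cast_ofNat,
    Nat.reduceSub, pow_one, Real.exp_neg, div_pow, mul_pow, hs]
  field_simp
  ring

theorem hasDerivAt_bder (τ : ℝ) : HasDerivAt bder ((1 - 3 * aa τ ^ 2) * bb τ) τ := by
  refine ((hasDerivAt_aa τ).sub ((hasDerivAt_aa τ).pow 3)).congr_deriv ?_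
  norm_num
  ring

theorem hasDerivAt_hh (τ : ℝ) : HasDerivAt hh (3 + 2 * bb τ * hh τ / aa τ) τ := by
  have hd : Real.exp τ + Real.exp (-τ) ≠ 0 := by positivity
  have h2 : HasDerivAt (fun s : ℝ => 2 * s) 2 τ := by
    simpa using (hasDerivAt_id τ).const_mul 2
  have h4 : HasDerivAt (fun s : ℝ => 4 * s) 4 τ := by
    simpa using (hasDerivAt_id τ).const_mul 4
  refine ((((h2.exp.sub h2.neg.exp).add h4).const_mul 3).div
    (((hasDerivAt_exp_add_exp_neg τ).pow 2).const_mul 2)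
    (mul_ne_zero two_ne_zero (pow_ne_zero 2 hd))).congr_deriv ?_
  have hc : Real.exp τ ≠ 0 := (Real.exp_pos τ).ne'
  have hd' : Real.exp τ + (Real.exp τ)⁻¹ ≠ 0 := by positivity
  have hs : Real.sqrt 2 ≠ 0 := by positivity
  have he : Real.exp (2 * τ) = Real.exp τ ^ 2 := by
    rw [two_mul, Real.exp_add, sq]
  unfold hh bb aa
  simp only [Pi.add_apply, Pi.sub_apply, Pi.neg_apply, Pi.pow_apply, Nat.cast_ofNat,
    Nat.reduceSub, pow_one, Real.exp_neg, he]
  field_simp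
  ring

theorem hasDerivAt_HH (τ : ℝ) : HasDerivAt HH (HT τ + bb τ / aa τ * HH τ) τ := by
  have ha := aa_ne_zero τ
  refine ((((hasDerivAt_bb τ).mul (hasDerivAt_hh τ)).add (hasDerivAt_aa τ)).div
    (hasDerivAt_aa τ) ha).congr_deriv ?_
  simp only [Pi.add_apply, Pi.mul_apply, HT, HH]
  field_simp
  ring

theorem hasDerivAt_HT (τ : ℝ) :
    HasDerivAt HT ((1 - 3 * aa τ ^ 2) * HH τ + bb τ / aa τ * HT τ) τ := by
  have ha := aa_ne_zero τ
  refine ((((hasDerivAt_bder τ).mul (hasDerivAt_hh τ)).add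
    ((hasDerivAt_bb τ).const_mul 2)).div (hasDerivAt_aa τ) ha).congr_deriv ?_
  simp only [Pi.add_apply, Pi.mul_apply, HT, HH, bder]
  field_simp
  linear_combination (-4) * bb_sq τ

/-- If `x' = y + P` and `y' = (1 − 3a²)x + Q`, then `M = (b'x − by)/a` and `W = H̃x − Hy`
satisfy `M' = −(b/a)M + (1/a)(b'P − bQ)` and `W' = (b/a)W + H̃P − HQ`. -/
theorem canonical_coordinates_perturbed
    (P Q : ℝ → ℝ) (hP : Continuous P) (hQ : Continuous Q)
    (x y : ℝ → ℝ)
    (hx : ∀ τ, HasDerivAt x (y τ + P τ) τ)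
    (hy : ∀ τ, HasDerivAt y ((1 - 3 * (aa τ) ^ 2) * x τ + Q τ) τ) :
    ∀ τ : ℝ,
      HasDerivAt (fun s => (bder s * x s - bb s * y s) / aa s)
        (-(bb τ / aa τ) * ((bder τ * x τ - bb τ * y τ) / aa τ)
          + (1 / aa τ) * (bder τ * P τ - bb τ * Q τ)) τ ∧
      HasDerivAt (fun s => HT s * x s - HH s * y s)
        ((bb τ / aa τ) * (HT τ * x τ - HH τ * y τ) + HT τ * P τ - HH τ * Q τ) τ := by
  intro τ
  have ha := aa_ne_zero τ
  constructor
  · refine ((((hasDerivAt_bder τ).mul (hx τ)).sub ((hasDerivAt_bb τ).mul (hy τ))).div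
      (hasDerivAt_aa τ) ha).congr_deriv ?_
    simp only [Pi.sub_apply, Pi.mul_apply]
    field_simp
    ring
  · refine (((hasDerivAt_HT τ).mul (hx τ)).sub
      ((hasDerivAt_HH τ).mul (hy τ))).congr_deriv ?_
    ring
end

section
/- Let ε > 0, let n, m ≥ 0 be integers, let j ∈ {1, 2}, and set δ(j) = (1 + (−1)^j)/2. Then: (i) ε^{4n} ∫_{−∞}^{∞} a(τ)^{4n+4+(−1)^j} e^{i (2m+1) ψ_ε(τ)} dτ = −(2/3) (2√2)^{4(n+1)+(−1)^j} ε^{4n} ∫_{−∞}^{∞} e^{− i (2m+1) z/(24 ε³)} (y(z) + 2i)^{−(2(n+m+2)+δ(j))} (y(z) − 2i)^{−(2(n−m+1)+δ(j))} dz; and (ii) for n ≥ 1 and m ≥ 1, ε^{4n−2} ∫_{−∞}^{∞} a(τ)^{4n+2+(−1)^j} e^{i 2m ψ_ε(τ)} dτ = (2/3) (2√2)^{4n+2+(−1)^j} ε^{4n−2} ∫_{−∞}^{∞} e^{− i m z/(12 ε³)} (y(z) + 2i)^{−(2(n+m+1)+δ(j))} (y(z) − 2i)^{−(2(n−m+1)+δ(j))}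 dz. Negative integer exponents denote positive powers in the numerator. -/
open MeasureTheory

/-- `ψ_ε(τ)`. -/
noncomputable def psi (ε τ : ℝ) : ℝ :=
  2 * Real.arctan ((Real.exp τ - Real.exp (-τ)) / 2)
    - (1 / (48 * ε ^ 3)) * (Real.exp (3 * τ) - Real.exp (-(3 * τ)))
    - (3 / (16 * ε ^ 3)) * (Real.exp τ - Real.exp (-τ))

/-- `y(z) = (√(z² + 64) + z)^{1/3} − (√(z² + 64) − z)^{1/3}`. -/
noncomputable def yy (z : ℝ) : ℝ :=
  (Real.sqrt (z ^ 2 + 64) + z) ^ ((1 : ℝ) / 3) - (Real.sqrt (z ^ 2 + 64) - z) ^ ((1 : ℝ) / 3)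

theorem yy_cubic (z : ℝ) : yy z ^ 3 + 12 * yy z = 2 * z := by
  have hs : Real.sqrt (z ^ 2 + 64) ^ 2 = z ^ 2 + 64 := Real.sq_sqrt (by positivity)
  have habs : |z| ≤ Real.sqrt (z ^ 2 + 64) := Real.abs_le_sqrt (by linarith)
  obtain ⟨h₁, h₂⟩ := abs_le.mp habs
  have hp : 0 ≤ Real.sqrt (z ^ 2 + 64) + z := by linarith
  have hm : 0 ≤ Real.sqrt (z ^ 2 + 64) - z := by linarith
  have cube : ∀ w : ℝ, 0 ≤ w → (w ^ ((1 : ℝ) / 3)) ^ 3 = w := fun w hw => by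
    rw [← Real.rpow_natCast, ← Real.rpow_mul hw]
    norm_num
  have hprod : (Real.sqrt (z ^ 2 + 64) + z) ^ ((1 : ℝ) / 3) *
      (Real.sqrt (z ^ 2 + 64) - z) ^ ((1 : ℝ) / 3) = 4 := by
    rw [← Real.mul_rpow hp hm,
      show (Real.sqrt (z ^ 2 + 64) + z) * (Real.sqrt (z ^ 2 + 64) - z) = (4 : ℝ) ^ (3 : ℝ) by
        norm_num
        linear_combination hs,
      ← Real.rpow_mul (by norm_num)]
    norm_num
  have hcp := cube _ hp
  have hcm := cube _ hm
  unfold yy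
  set u := (Real.sqrt (z ^ 2 + 64) + z) ^ ((1 : ℝ) / 3)
  set v := (Real.sqrt (z ^ 2 + 64) - z) ^ ((1 : ℝ) / 3)
  linear_combination hcp - hcm - 3 * (u - v) * hprod

theorem cubic_injective {x y : ℝ} (h : x ^ 3 + 12 * x = y ^ 3 + 12 * y) : x = y := by
  have h' : (x - y) * (x ^ 2 + x * y + y ^ 2 + 12) = 0 := by linear_combination h
  have hpos : x ^ 2 + x * y + y ^ 2 + 12 ≠ 0 := by
    nlinarith [sq_nonneg (x + y), sq_nonneg x, sq_nonneg y]
  linarith [(mul_eq_zero.mp h').resolve_right hpos]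

/-- The substitution `τ ↦ (y³ + 12 y) / 2` with `y = 2 sinh τ`, a right inverse of which is given
by `yy`. -/
noncomputable def cubicSinh (τ : ℝ) : ℝ := ((2 * Real.sinh τ) ^ 3 + 12 * (2 * Real.sinh τ)) / 2

theorem yy_cubicSinh (τ : ℝ) : yy (cubicSinh τ) = 2 * Real.sinh τ := by
  apply cubic_injective
  rw [yy_cubic, cubicSinh]
  ring

theorem cubicSinh_injective : Function.Injective cubicSinh := fun s t h => by
  have h' := congrArg yy h
  rw [yy_cubicSinh, yy_cubicSinh] at h'
  exact Real.sinh_injective (by linarith)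

theorem cubicSinh_surjective : Function.Surjective cubicSinh := fun z => by
  refine ⟨Real.arsinh (yy z / 2), ?_⟩
  rw [cubicSinh, Real.sinh_arsinh]
  linear_combination yy_cubic z / 2

theorem hasDerivAt_cubicSinh (τ : ℝ) :
    HasDerivAt cubicSinh (3 / 2 * (2 * Real.cosh τ) ^ 3) τ := by
  have h := (Real.hasDerivAt_sinh τ).const_mul 2
  refine (((h.pow 3).add (h.const_mul 12)).div_const 2).congr_deriv ?_
  push_cast
  linear_combination -12 * Real.cosh τ * Real.cosh_sq τ

theorem integral_eq_integral_cubicSinh (g : ℝ → ℂ) :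
    ∫ z, g z = ∫ τ, ((3 / 2 * (2 * Real.cosh τ) ^ 3 : ℝ) : ℂ) * g (cubicSinh τ) := by
  have h := integral_image_eq_integral_abs_deriv_smul MeasurableSet.univ
    (fun τ _ => (hasDerivAt_cubicSinh τ).hasDerivWithinAt) cubicSinh_injective.injOn g
  rw [Set.image_univ, cubicSinh_surjective.range_eq, Measure.restrict_univ] at h
  rw [h]
  refine integral_congr_ae (.of_forall fun τ => ?_)
  have := Real.cosh_pos τ
  simp only [Complex.real_smul]
  rw [abs_of_pos (by positivity)]

theorem aa_eq (τ : ℝ) : aa τ = 2 * Real.sqrt 2 / (2 * Real.cosh τ) := by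
  rw [aa, Real.cosh_eq]
  ring

theorem psi_eq (ε τ : ℝ) :
    psi ε τ = 2 * Real.arctan (Real.sinh τ) - cubicSinh τ / (24 * ε ^ 3) := by
  have h₃ : Real.exp (3 * τ) - Real.exp (-(3 * τ)) = 2 * Real.sinh (3 * τ) := by
    rw [Real.sinh_eq]
    ring
  have h₁ : Real.exp τ - Real.exp (-τ) = 2 * Real.sinh τ := by
    rw [Real.sinh_eq]
    ring
  rw [psi, h₃, h₁, Real.sinh_three_mul, cubicSinh, mul_div_cancel_left₀ _ (two_ne_zero' ℝ)]
  ring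

theorem two_sinh_add_two_I_ne_zero (τ : ℝ) :
    ((2 * Real.sinh τ : ℝ) : ℂ) + 2 * Complex.I ≠ 0 := fun h => by
  simpa using congrArg Complex.im h

theorem two_sinh_sub_two_I_ne_zero (τ : ℝ) :
    ((2 * Real.sinh τ : ℝ) : ℂ) - 2 * Complex.I ≠ 0 := fun h => by
  simpa using congrArg Complex.im h

theorem two_cosh_sq_eq_mul (τ : ℝ) :
    ((2 * Real.cosh τ : ℝ) : ℂ) ^ 2 =
      (((2 * Real.sinh τ : ℝ) : ℂ) + 2 * Complex.I) *
        (((2 * Real.sinh τ : ℝ) : ℂ) - 2 * Complex.I) := by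
  have h : ((Real.cosh τ : ℝ) : ℂ) ^ 2 = ((Real.sinh τ : ℝ) : ℂ) ^ 2 + 1 := by
    exact_mod_cast Real.cosh_sq τ
  rw [Complex.ofReal_mul, Complex.ofReal_mul]
  push_cast at h ⊢
  linear_combination 4 * h + 4 * Complex.I_sq

theorem exp_two_arctan_sinh (τ : ℝ) :
    Complex.exp (Complex.I * ((2 * Real.arctan (Real.sinh τ) : ℝ) : ℂ)) =
      -((((2 * Real.sinh τ : ℝ) : ℂ) - 2 * Complex.I) /
        (((2 * Real.sinh τ : ℝ) : ℂ) + 2 * Complex.I)) := by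
  have hc := Real.cosh_pos τ
  have hsqrt : Real.sqrt (1 + Real.sinh τ ^ 2) = Real.cosh τ := by
    rw [← Real.cosh_sq', Real.sqrt_sq hc.le]
  have hexp : Complex.exp (Complex.I * (Real.arctan (Real.sinh τ) : ℂ)) =
      (1 + Real.sinh τ * Complex.I) / Real.cosh τ := by
    rw [mul_comm, Complex.exp_mul_I, ← Complex.ofReal_cos, ← Complex.ofReal_sin,
      Real.cos_arctan, Real.sin_arctan, hsqrt]
    push_cast
    ring
  have hc' : (Real.cosh τ : ℂ) ≠ 0 := by exact_mod_cast hc.ne'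
  have hsq := two_cosh_sq_eq_mul τ
  have hne := two_sinh_add_two_I_ne_zero τ
  rw [Complex.ofReal_mul, ← mul_assoc, mul_comm Complex.I, mul_assoc, Complex.ofReal_ofNat,
    two_mul, Complex.exp_add, hexp, ← neg_div, div_mul_div_comm,
    div_eq_div_iff (mul_ne_zero hc' hc') hne]
  generalize Real.sinh τ = s at *
  generalize Real.cosh τ = c at *
  push_cast at hsq ⊢
  linear_combination ((2 * s - 2 * Complex.I) / 4) * hsq +
    2 * (s + Complex.I) * (s ^ 2 + 1) * Complex.I_sq

theorem aa_zpow_mul_exp_psi (ε τ : ℝ) (M : ℕ) (k : ℤ) :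
    (((aa τ) ^ (2 * k - 3) : ℝ) : ℂ) * Complex.exp (Complex.I * (M : ℂ) * (psi ε τ : ℂ)) =
      (-1) ^ M * (2 / 3 : ℂ) * ((2 * Real.sqrt 2 : ℝ) : ℂ) ^ (2 * k - 3) *
        (((3 / 2 * (2 * Real.cosh τ) ^ 3 : ℝ) : ℂ) *
          (Complex.exp (-(Complex.I * (M : ℂ) * (cubicSinh τ : ℂ)) / (24 * (ε : ℂ) ^ 3)) *
            ((yy (cubicSinh τ) : ℂ) + 2 * Complex.I) ^ (-(k + M)) *
            ((yy (cubicSinh τ) : ℂ) - 2 * Complex.I) ^ (-(k - M)))) := by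
  have hc : ((2 * Real.cosh τ : ℝ) : ℂ) ≠ 0 := by
    have := Real.cosh_pos τ
    exact_mod_cast (by positivity : 2 * Real.cosh τ ≠ 0)
  have hp := two_sinh_add_two_I_ne_zero τ
  have hm := two_sinh_sub_two_I_ne_zero τ
  have hsq := two_cosh_sq_eq_mul τ
  have hexp : Complex.exp (Complex.I * (M : ℂ) * (psi ε τ : ℂ)) =
      (-((((2 * Real.sinh τ : ℝ) : ℂ) - 2 * Complex.I) /
        (((2 * Real.sinh τ : ℝ) : ℂ) + 2 * Complex.I))) ^ M *
      Complex.exp (-(Complex.I * (M : ℂ) * (cubicSinh τ : ℂ)) / (24 * (ε : ℂ) ^ 3)) := by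
    rw [← exp_two_arctan_sinh, ← Complex.exp_nat_mul, ← Complex.exp_add, psi_eq]
    congr 1
    push_cast
    ring
  rw [hexp, yy_cubicSinh, aa_eq, div_zpow, Complex.ofReal_div, Complex.ofReal_zpow,
    Complex.ofReal_zpow, Complex.ofReal_mul (3 / 2), Complex.ofReal_pow]
  generalize ((2 * Real.cosh τ : ℝ) : ℂ) = c at *
  generalize ((2 * Real.sinh τ : ℝ) : ℂ) + 2 * Complex.I = p at *
  generalize ((2 * Real.sinh τ : ℝ) : ℂ) - 2 * Complex.I = q at *
  generalize Complex.exp _ = E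
  generalize ((2 * Real.sqrt 2 : ℝ) : ℂ) ^ (2 * k - 3) = A
  have hck : c ^ (2 * k - 3) = p ^ k * q ^ k / c ^ 3 := by
    rw [zpow_sub₀ hc, zpow_mul, ← mul_zpow, ← hsq]
    norm_cast
  rw [hck, neg_pow, div_pow, zpow_neg, zpow_neg, zpow_add₀ hp, zpow_sub₀ hm, zpow_natCast,
    zpow_natCast]
  push_cast
  field_simp

theorem integral_aa_zpow_mul_exp_psi (ε : ℝ) (M : ℕ) (k : ℤ) :
    ∫ τ : ℝ, (((aa τ) ^ (2 * k - 3) : ℝ) : ℂ) *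
        Complex.exp (Complex.I * (M : ℂ) * (psi ε τ : ℂ)) =
      (-1) ^ M * (2 / 3 : ℂ) * ((2 * Real.sqrt 2 : ℝ) : ℂ) ^ (2 * k - 3) *
        ∫ z : ℝ, Complex.exp (-(Complex.I * (M : ℂ) * (z : ℂ)) / (24 * (ε : ℂ) ^ 3)) *
          ((yy z : ℂ) + 2 * Complex.I) ^ (-(k + M)) *
          ((yy z : ℂ) - 2 * Complex.I) ^ (-(k - M)) := by
  rw [integral_eq_integral_cubicSinh fun z : ℝ => Complex.exp _ * _ ^ (-(k + M : ℤ)) * _, ← integral_const_mul]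
  simp_rw [aa_zpow_mul_exp_psi]

/-- The integrals `I^{(j)}_{n,m,odd}` and `I^{(j)}_{n,m,even}` expressed as integrals in the
variable `z`, with `δ(j) = (1 + (−1)^j)/2`. -/
theorem I_odd_even_change_of_variables
    (ε : ℝ) (hε : 0 < ε) (n m j : ℕ) (hj : j = 1 ∨ j = 2) :
    ((ε : ℂ) ^ (4 * n) *
        ∫ τ : ℝ, (((aa τ) ^ (4 * (n : ℤ) + 4 + (-1 : ℤ) ^ j) : ℝ) : ℂ) *
          Complex.exp (Complex.I * (2 * (m : ℂ) + 1) * (psi ε τ : ℂ))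
      = -(2 / 3 : ℂ) * ((2 * Real.sqrt 2 : ℝ) : ℂ) ^ (4 * ((n : ℤ) + 1) + (-1 : ℤ) ^ j) *
          (ε : ℂ) ^ (4 * n) *
          ∫ z : ℝ,
            Complex.exp (-(Complex.I * (2 * (m : ℂ) + 1) * (z : ℂ)) / (24 * (ε : ℂ) ^ 3)) *
              ((yy z : ℂ) + 2 * Complex.I) ^
                (-(2 * ((n : ℤ) + (m : ℤ) + 2) + (1 + (-1 : ℤ) ^ j) / 2)) *
              ((yy z : ℂ) - 2 * Complex.I) ^
                (-(2 * ((n : ℤ) - (m : ℤ) + 1) + (1 + (-1 : ℤ) ^ j) / 2))) ∧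
    (1 ≤ n → 1 ≤ m →
      (ε : ℂ) ^ (4 * (n : ℤ) - 2) *
          ∫ τ : ℝ, (((aa τ) ^ (4 * (n : ℤ) + 2 + (-1 : ℤ) ^ j) : ℝ) : ℂ) *
            Complex.exp (Complex.I * 2 * (m : ℂ) * (psi ε τ : ℂ))
        = (2 / 3 : ℂ) * ((2 * Real.sqrt 2 : ℝ) : ℂ) ^ (4 * (n : ℤ) + 2 + (-1 : ℤ) ^ j) *
            (ε : ℂ) ^ (4 * (n : ℤ) - 2) *
            ∫ z : ℝ,
              Complex.exp (-(Complex.I * (m : ℂ) * (z : ℂ)) / (12 * (ε : ℂ) ^ 3)) *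
                ((yy z : ℂ) + 2 * Complex.I) ^
                  (-(2 * ((n : ℤ) + (m : ℤ) + 1) + (1 + (-1 : ℤ) ^ j) / 2)) *
                ((yy z : ℂ) - 2 * Complex.I) ^
                  (-(2 * ((n : ℤ) - (m : ℤ) + 1) + (1 + (-1 : ℤ) ^ j) / 2))) := by
  obtain ⟨d, hd, hd'⟩ : ∃ d : ℤ, (-1 : ℤ) ^ j = 2 * d - 1 ∧ (1 + (-1 : ℤ) ^ j) / 2 = d := by
    rcases hj with rfl | rfl
    · exact ⟨0, by norm_num⟩
    · exact ⟨1, by norm_num⟩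
  rw [hd', hd]
  constructor
  · have h := integral_aa_zpow_mul_exp_psi ε (2 * m + 1) (2 * n + 3 + d)
    rw [show 2 * (2 * (n : ℤ) + 3 + d) - 3 = 4 * n + 4 + (2 * d - 1) by ring,
      show 2 * (n : ℤ) + 3 + d + (2 * m + 1 : ℕ) = 2 * (n + m + 2) + d by push_cast; ring,
      show 2 * (n : ℤ) + 3 + d - (2 * m + 1 : ℕ) = 2 * (n - m + 1) + d by push_cast; ring,
      Odd.neg_one_pow ⟨m, rfl⟩, Nat.cast_add, Nat.cast_mul, Nat.cast_ofNat, Nat.cast_one] at h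
    rw [h, show 4 * ((n : ℤ) + 1) = 4 * n + 4 by ring]
    ring
  · intro _ _
    have h := integral_aa_zpow_mul_exp_psi ε (2 * m) (2 * n + 2 + d)
    have hexp (z : ℝ) : -(Complex.I * (2 * (m : ℂ)) * (z : ℂ)) / (24 * (ε : ℂ) ^ 3) =
        -(Complex.I * (m : ℂ) * (z : ℂ)) / (12 * (ε : ℂ) ^ 3) := by
      rw [show -(Complex.I * (2 * (m : ℂ)) * (z : ℂ)) = 2 * -(Complex.I * m * z) by ring,
        show 24 * (ε : ℂ) ^ 3 = 2 * (12 * (ε : ℂ) ^ 3) by ring,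
        mul_div_mul_left _ _ two_ne_zero]
    rw [show 2 * (2 * (n : ℤ) + 2 + d) - 3 = 4 * n + 2 + (2 * d - 1) by ring,
      show 2 * (n : ℤ) + 2 + d + (2 * m : ℕ) = 2 * (n + m + 1) + d by push_cast; ring,
      show 2 * (n : ℤ) + 2 + d - (2 * m : ℕ) = 2 * (n - m + 1) + d by push_cast; ring,
      (even_two_mul m).neg_one_pow, Nat.cast_mul, Nat.cast_ofNat] at h
    simp_rw [hexp] at h
    simp_rw [mul_assoc Complex.I 2 (m : ℂ)]
    rw [h]
    ring
end
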